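/- arXiv:2211.16223 — 4 statements merged into one kernel-verified Lean document; each statement's English description precedes it below -/
import Mathlib

section
/- Dyson integration lemma: let (X, μ) be a measure space and K : X × X → ℂ a measurable kernel such that (i) for all x, y ∈ X the function z ↦ K(x,z)K(z,y) is μ-integrable with ∫_X K(x,z) K(z,y) dμ(z) = K(x,y), and (ii) z ↦ K(z,z) is μ-integrable with ∫_X K(z,z) dμ(z) = c for some constant c ∈ ℂ. Then for every integer m ≥ 1 and all fixed x₁,…,x_{m-1} ∈ X, provided z ↦ det[K(x_j,x_k)]_{j,k=1}^m (with x_m replaced by z) is μ-integrable, one has ∫_X det[ K(x_j, x_k) ]_{j,k=1}^m dμ(x_m) = (c − m + 1) · det[ K(x_j, x_k) ]_{j,k=1}^{m-1}. -/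
open MeasureTheory

/-- Expansion of a bordered determinant along its last row and last column. -/
theorem Matrix.det_succ_eq_mul_det_sub_sum_adjugate {R : Type*} [CommRing R] {n : ℕ}
    (M : Matrix (Fin (n + 1)) (Fin (n + 1)) R) :
    M.det = M (Fin.last n) (Fin.last n) * (M.submatrix Fin.castSucc Fin.castSucc).det -
      ∑ j : Fin n, ∑ i : Fin n, (M.submatrix Fin.castSucc Fin.castSucc).adjugate j i *
        (M (Fin.last n) j.castSucc * M i.castSucc (Fin.last n)) := by
  cases n with
  | zero => simp [Fin.last]
  | succ m =>
    have hlast : (-1 : R) ^ (m + 1 + (m + 1)) = 1 := Even.neg_one_pow ⟨m + 1, rfl⟩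
    rw [Matrix.det_succ_row M (Fin.last (m + 1)), Fin.sum_univ_castSucc, add_comm, sub_eq_add_neg,
      ← Finset.sum_neg_distrib]
    congr 1
    · simp only [Fin.val_last, hlast, one_mul, Fin.succAbove_last]
    · refine Finset.sum_congr rfl fun j _ => ?_
      rw [Matrix.det_succ_column _ (Fin.last m), Finset.mul_sum, ← Finset.sum_neg_distrib]
      refine Finset.sum_congr rfl fun i _ => ?_
      have hsub : ((M.submatrix (Fin.last (m + 1)).succAbove j.castSucc.succAbove).submatrix
          i.succAbove (Fin.last m).succAbove) =
          (M.submatrix Fin.castSucc Fin.castSucc).submatrix i.succAbove j.succAbove := by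
        ext a b
        simp [Fin.castSucc_succAbove_castSucc]
      have hcol : j.castSucc.succAbove (Fin.last m) = Fin.last (m + 1) := by
        rw [Fin.succAbove_castSucc_of_le _ _ (Fin.le_last j), Fin.succ_last]
      have hsign : (-1 : R) ^ (m + 1 + j.val) * (-1) ^ (i.val + m) = -(-1) ^ (i.val + j.val) := by
        linear_combination (-(-1) ^ (i.val + j.val)) * hlast
      rw [hsub, Matrix.adjugate_fin_succ_eq_det_submatrix]
      simp only [Fin.val_last, Fin.val_castSucc, Matrix.submatrix_apply, Fin.succAbove_last, hcol]
      linear_combination (M (Fin.last (m + 1)) j.castSucc * M i.castSucc (Fin.last (m + 1)) *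
        ((M.submatrix Fin.castSucc Fin.castSucc).submatrix i.succAbove j.succAbove).det) * hsign

/-- Dyson integration lemma: if `K` is a reproducing kernel with trace `c`,
then integrating out the last variable of the `m × m` determinant
`det[K(x_j, x_k)]` (with `m = n+1`, last variable `z`) yields
`(c - m + 1) det[K(x_j, x_k)]_{j,k=1}^{m-1}`. -/
theorem dyson_integration {X : Type*} [MeasurableSpace X] (μ : Measure X)
    (K : X → X → ℂ) (hK : Measurable fun p : X × X => K p.1 p.2) (c : ℂ)
    (hrep : ∀ x y : X, Integrable (fun z => K x z * K z y) μ ∧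
      (∫ z, K x z * K z y ∂μ) = K x y)
    (hdiag : Integrable (fun z => K z z) μ)
    (htrace : (∫ z, K z z ∂μ) = c)
    (n : ℕ) (x : Fin n → X)
    (hint : Integrable (fun z =>
      Matrix.det (Matrix.of fun j k : Fin (n + 1) =>
        K ((Fin.snoc x z : Fin (n + 1) → X) j) ((Fin.snoc x z : Fin (n + 1) → X) k))) μ) :
    (∫ z, Matrix.det (Matrix.of fun j k : Fin (n + 1) =>
        K ((Fin.snoc x z : Fin (n + 1) → X) j) ((Fin.snoc x z : Fin (n + 1) → X) k)) ∂μ)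
      = (c - n) * Matrix.det (Matrix.of fun j k : Fin n => K (x j) (x k)) := by
  set A : Matrix (Fin n) (Fin n) ℂ := Matrix.of fun j k => K (x j) (x k) with hA
  have hdet (z : X) : Matrix.det (Matrix.of fun j k : Fin (n + 1) =>
        K ((Fin.snoc x z : Fin (n + 1) → X) j) ((Fin.snoc x z : Fin (n + 1) → X) k)) =
      K z z * A.det - ∑ j, ∑ i, A.adjugate j i * (K (x i) z * K z (x j)) := by
    have hsub : (Matrix.of fun j k : Fin (n + 1) =>
        K ((Fin.snoc x z : Fin (n + 1) → X) j)
          ((Fin.snoc x z : Fin (n + 1) → X) k)).submatrix Fin.castSucc Fin.castSucc = A := by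
      ext a b
      simp [hA]
    rw [Matrix.det_succ_eq_mul_det_sub_sum_adjugate, hsub]
    simp only [Matrix.of_apply, Fin.snoc_last, Fin.snoc_castSucc, mul_comm (K z (x _))]
  have hterm (j i : Fin n) :
      Integrable (fun z => A.adjugate j i * (K (x i) z * K z (x j))) μ :=
    (hrep (x i) (x j)).1.const_mul _
  have hsum (j : Fin n) : ∑ i, A.adjugate j i * A i j = A.det := by
    rw [← Matrix.mul_apply, Matrix.adjugate_mul]
    simp
  simp_rw [hdet]
  rw [integral_sub (hdiag.mul_const _)
      (integrable_finsetSum _ fun j _ => integrable_finsetSum _ fun i _ => hterm j i),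
    integral_mul_const, htrace,
    integral_finsetSum _ fun j _ => integrable_finsetSum _ fun i _ => hterm j i]
  have hinner (j : Fin n) :
      ∫ z, ∑ i, A.adjugate j i * (K (x i) z * K z (x j)) ∂μ = A.det := by
    rw [integral_finsetSum _ fun i _ => hterm j i, ← hsum j]
    refine Finset.sum_congr rfl fun i _ => ?_
    rw [integral_const_mul, (hrep (x i) (x j)).2]
    rfl
  simp only [hinner, Finset.sum_const, Finset.card_univ, Fintype.card_fin, nsmul_eq_mul]
  ring
end

section
/- Planar orthogonality of scaled Hermite polynomials: for every 0 < τ < 1 and all nonnegative integers m, n, ∫_{ℝ²} e^{-x²/(1+τ) − y²/(1−τ)} C_m(x+iy) C_n(x−iy) dx dy = π · m! · √(1−τ²) · δ_{m,n}, where C_n(z) := (τ/2)^{n/2} H_n( z/√(2τ) ). -/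
open MeasureTheory Finset

/-- The `n`-th physicists' Hermite polynomial, via the Rodrigues formula
`H_n(z) = (-1)^n e^{z²} (d/dz)^n e^{-z²}`, extended to complex argument
(the unique entire extension, since `H_n` has real coefficients). -/
noncomputable def physHermite (n : ℕ) (z : ℂ) : ℂ :=
  (-1 : ℂ) ^ n * Complex.exp (z ^ 2) *
    iteratedDeriv n (fun t : ℂ => Complex.exp (-t ^ 2)) z

/-- The scaled monic Hermite polynomial `C_n(z) = (τ/2)^{n/2} H_n(z/√(2τ))`. -/
noncomputable def scaledHermite (τ : ℝ) (n : ℕ) (z : ℂ) : ℂ :=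
  ((Real.sqrt (τ / 2) : ℝ) : ℂ) ^ n *
    physHermite n (z / ((Real.sqrt (2 * τ) : ℝ) : ℂ))

open Polynomial in
/-- The monic polynomials with `p₀ = 1` and `pₙ₊₁ = X pₙ - τ pₙ'`; their values are those of
`scaledHermite τ n`. -/
noncomputable def scaledHermitePoly (τ : ℝ) : ℕ → ℂ[X]
  | 0 => 1
  | n + 1 => X * scaledHermitePoly τ n - C (τ : ℂ) * derivative (scaledHermitePoly τ n)

/-- The elliptic Gaussian weight of the planar Hermite polynomials. -/
noncomputable def ellipticWeight (τ : ℝ) (p : ℝ × ℝ) : ℝ :=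
  Real.exp (-p.1 ^ 2 / (1 + τ) - p.2 ^ 2 / (1 - τ))

/-- The integrand of the planar pairing of two polynomials. -/
noncomputable def planarIntegrand (τ : ℝ) (f g : Polynomial ℂ) (p : ℝ × ℝ) : ℂ :=
  (ellipticWeight τ p : ℂ) * f.eval ((p.1 : ℂ) + (p.2 : ℂ) * Complex.I) *
    g.eval ((p.1 : ℂ) - (p.2 : ℂ) * Complex.I)

open Polynomial in
theorem derivative_scaledHermitePoly_succ (τ : ℝ) (n : ℕ) :
    derivative (scaledHermitePoly τ (n + 1)) = C ((n : ℂ) + 1) * scaledHermitePoly τ n := by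
  induction n with
  | zero => simp [scaledHermitePoly]
  | succ n ih =>
    rw [scaledHermitePoly, derivative_sub, derivative_mul, derivative_X, derivative_C_mul, ih,
      derivative_C_mul]
    have h : scaledHermitePoly τ (n + 1) =
      X * scaledHermitePoly τ n - C (τ : ℂ) * derivative (scaledHermitePoly τ n) := rfl
    push_cast
    simp only [map_add, map_one]
    linear_combination -(C (n : ℂ) + 1) * h

theorem iteratedDeriv_exp_neg_sq (τ : ℝ) (h0 : 0 < τ) (n : ℕ) :
    iteratedDeriv n (fun t : ℂ => Complex.exp (-t ^ 2)) = fun z =>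
      (-2 / ((Real.sqrt (2 * τ) : ℝ) : ℂ)) ^ n *
        (scaledHermitePoly τ n).eval (z * ((Real.sqrt (2 * τ) : ℝ) : ℂ)) *
          Complex.exp (-z ^ 2) := by
  have hk : ((Real.sqrt (2 * τ) : ℝ) : ℂ) ≠ 0 := by
    exact_mod_cast (Real.sqrt_pos.2 (by positivity)).ne'
  have hk2 : ((Real.sqrt (2 * τ) : ℝ) : ℂ) ^ 2 = 2 * τ := by
    exact_mod_cast Real.sq_sqrt (by positivity : 0 ≤ 2 * τ)
  generalize ((Real.sqrt (2 * τ) : ℝ) : ℂ) = k at hk hk2 ⊢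
  induction n with
  | zero => simp [scaledHermitePoly]
  | succ n ih =>
    rw [iteratedDeriv_succ, ih]
    funext z
    have hτ : (τ : ℂ) = k ^ 2 / 2 := by rw [hk2]; ring
    have h₁ := ((scaledHermitePoly τ n).hasDerivAt (z * k)).comp z ((hasDerivAt_id z).mul_const k)
    have h₂ : HasDerivAt (fun t : ℂ => Complex.exp (-t ^ 2)) _ z := ((hasDerivAt_pow 2 z).neg).cexp
    refine ((h₁.const_mul ((-2 / k) ^ n)).mul h₂).deriv.trans ?_
    simp only [scaledHermitePoly, Polynomial.eval_sub, Polynomial.eval_mul, Polynomial.eval_X,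
      Polynomial.eval_C, Function.comp, id, hτ, pow_succ (-2 / k) n]
    generalize (-2 / k) ^ n = c
    simp
    field_simp
    ring

theorem scaledHermite_eq_eval (τ : ℝ) (h0 : 0 < τ) (n : ℕ) (z : ℂ) :
    scaledHermite τ n z = (scaledHermitePoly τ n).eval z := by
  have hk : ((Real.sqrt (2 * τ) : ℝ) : ℂ) ≠ 0 := by
    exact_mod_cast (Real.sqrt_pos.2 (by positivity)).ne'
  have hs : ((Real.sqrt (τ / 2) : ℝ) : ℂ) * 2 / ((Real.sqrt (2 * τ) : ℝ) : ℂ) = 1 := by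
    rw [div_eq_one_iff_eq hk]
    have h : 2 * τ = 2 ^ 2 * (τ / 2) := by ring
    rw [h, Real.sqrt_mul (by positivity), Real.sqrt_sq (by norm_num)]
    push_cast
    ring
  rw [scaledHermite, physHermite, iteratedDeriv_exp_neg_sq τ h0]
  beta_reduce
  rw [div_mul_cancel₀ _ hk]
  set w := z / ((Real.sqrt (2 * τ) : ℝ) : ℂ)
  have he : Complex.exp (w ^ 2) * Complex.exp (-w ^ 2) = 1 := by
    rw [← Complex.exp_add]; simp
  calc _ = (((Real.sqrt (τ / 2) : ℝ) : ℂ) * (-1) * (-2 / ((Real.sqrt (2 * τ) : ℝ) : ℂ))) ^ n *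
        (scaledHermitePoly τ n).eval z * (Complex.exp (w ^ 2) * Complex.exp (-w ^ 2)) := by
        rw [mul_pow, mul_pow]; ring
    _ = _ := by
        rw [he, show ((Real.sqrt (τ / 2) : ℝ) : ℂ) * (-1) * (-2 / ((Real.sqrt (2 * τ) : ℝ) : ℂ)) =
          ((Real.sqrt (τ / 2) : ℝ) : ℂ) * 2 / ((Real.sqrt (2 * τ) : ℝ) : ℂ) by ring, hs]
        simp

theorem ellipticWeight_eq_mul (τ : ℝ) (p : ℝ × ℝ) :
    ellipticWeight τ p =
      Real.exp (-(1 / (1 + τ)) * p.1 ^ 2) * Real.exp (-(1 / (1 - τ)) * p.2 ^ 2) := by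
  rw [ellipticWeight, ← Real.exp_add]
  congr 1
  ring

theorem integrable_pow_mul_gaussian {b : ℝ} (hb : 0 < b) (a : ℕ) :
    Integrable fun x : ℝ => x ^ a * Real.exp (-b * x ^ 2) := by
  have h := integrable_rpow_mul_exp_neg_mul_sq hb (s := a)
    (by have := a.cast_nonneg (α := ℝ); linarith)
  simpa using h

theorem integrable_monomial_mul_ellipticWeight {τ : ℝ} (h0 : 0 < τ) (h1 : τ < 1) (i j a b : ℕ) :
    Integrable fun p : ℝ × ℝ => (p.1 : ℂ) ^ a * (p.2 : ℂ) ^ b * ((ellipticWeight τ p : ℂ) *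
      ((p.1 : ℂ) + (p.2 : ℂ) * Complex.I) ^ i * ((p.1 : ℂ) - (p.2 : ℂ) * Complex.I) ^ j) := by
  induction i generalizing a b with
  | zero =>
    induction j generalizing a b with
    | zero =>
      have h := ((integrable_pow_mul_gaussian (b := 1 / (1 + τ)) (by positivity) a).mul_prod
        (integrable_pow_mul_gaussian (b := 1 / (1 - τ))
          (one_div_pos.2 (sub_pos.2 h1)) b)).ofReal (𝕜 := ℂ)
      refine h.congr (.of_forall fun p => ?_)
      simp only [ellipticWeight_eq_mul]
      push_cast
      simp
      ring
    | succ j ih =>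
      refine ((ih (a + 1) b).sub ((ih a (b + 1)).mul_const Complex.I)).congr
        (.of_forall fun p => ?_)
      simp only [Pi.sub_apply]
      ring
  | succ i ih =>
    refine ((ih (a + 1) b).add ((ih a (b + 1)).mul_const Complex.I)).congr
      (.of_forall fun p => ?_)
    simp only [Pi.add_apply]
    ring

theorem integrable_planarIntegrand {τ : ℝ} (h0 : 0 < τ) (h1 : τ < 1) (f g : Polynomial ℂ) :
    Integrable (planarIntegrand τ f g) := by
  induction f using Polynomial.induction_on' with
  | add f₁ f₂ hf₁ hf₂ =>
    refine (hf₁.add hf₂).congr (.of_forall fun p => ?_)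
    simp only [planarIntegrand, Pi.add_apply, Polynomial.eval_add]
    ring
  | monomial i c =>
    induction g using Polynomial.induction_on' with
    | add g₁ g₂ hg₁ hg₂ =>
      refine (hg₁.add hg₂).congr (.of_forall fun p => ?_)
      simp only [planarIntegrand, Pi.add_apply, Polynomial.eval_add]
      ring
    | monomial j d =>
      refine ((integrable_monomial_mul_ellipticWeight h0 h1 i j 0 0).mul_const (c * d)).congr
        (.of_forall fun p => ?_)
      simp only [planarIntegrand, Polynomial.eval_monomial]
      ring

open Polynomial in
theorem hasDerivAt_planarIntegrand_fst (τ : ℝ) (f g : ℂ[X]) (x y : ℝ) :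
    HasDerivAt (fun x => planarIntegrand τ f g (x, y))
      (planarIntegrand τ (derivative f) g (x, y) + planarIntegrand τ f (derivative g) (x, y) -
        ((1 + τ : ℝ) : ℂ)⁻¹ *
          (planarIntegrand τ (X * f) g (x, y) + planarIntegrand τ f (X * g) (x, y))) x := by
  have hw : HasDerivAt (fun x => ellipticWeight τ (x, y)) _ x :=
    ((((hasDerivAt_pow 2 x).neg).div_const (1 + τ)).sub_const (y ^ 2 / (1 - τ))).exp
  have hz : HasDerivAt (fun x : ℝ => (x : ℂ) + (y : ℂ) * Complex.I) 1 x :=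
    (hasDerivAt_id x).ofReal_comp.add_const _
  have hz' : HasDerivAt (fun x : ℝ => (x : ℂ) - (y : ℂ) * Complex.I) 1 x :=
    (hasDerivAt_id x).ofReal_comp.sub_const _
  have hf := (f.hasDerivAt ((x : ℂ) + (y : ℂ) * Complex.I)).comp x hz
  have hg := (g.hasDerivAt ((x : ℂ) - (y : ℂ) * Complex.I)).comp x hz'
  refine ((hw.ofReal_comp.mul hf).mul hg).congr_deriv ?_
  simp only [planarIntegrand, ellipticWeight, eval_mul, eval_X, Function.comp]
  push_cast
  simp
  ring

open Polynomial in
theorem hasDerivAt_planarIntegrand_snd (τ : ℝ) (f g : ℂ[X]) (x y : ℝ) :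
    HasDerivAt (fun y => planarIntegrand τ f g (x, y))
      (Complex.I *
        (planarIntegrand τ (derivative f) g (x, y) - planarIntegrand τ f (derivative g) (x, y) +
        ((1 - τ : ℝ) : ℂ)⁻¹ *
          (planarIntegrand τ (X * f) g (x, y) - planarIntegrand τ f (X * g) (x, y)))) y := by
  have hw : HasDerivAt (fun y => ellipticWeight τ (x, y)) _ y :=
    (((hasDerivAt_pow 2 y).div_const (1 - τ)).const_sub (-x ^ 2 / (1 + τ))).exp
  have hz : HasDerivAt (fun y : ℝ => (x : ℂ) + (y : ℂ) * Complex.I) (1 * Complex.I) y :=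
    ((hasDerivAt_id y).ofReal_comp.mul_const Complex.I).const_add _
  have hz' : HasDerivAt (fun y : ℝ => (x : ℂ) - (y : ℂ) * Complex.I) (-(1 * Complex.I)) y :=
    ((hasDerivAt_id y).ofReal_comp.mul_const Complex.I).const_sub _
  have hf := (f.hasDerivAt ((x : ℂ) + (y : ℂ) * Complex.I)).comp y hz
  have hg := (g.hasDerivAt ((x : ℂ) - (y : ℂ) * Complex.I)).comp y hz'
  refine ((hw.ofReal_comp.mul hf).mul hg).congr_deriv ?_
  simp only [planarIntegrand, ellipticWeight, eval_mul, eval_X, Function.comp]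
  push_cast
  simp
  ring_nf
  simp only [Complex.I_sq]
  ring

theorem integral_prod_eq_zero_of_hasDerivAt_fst {F F' : ℝ × ℝ → ℂ} (hF : Integrable F)
    (hF' : Integrable F') (h : ∀ x y, HasDerivAt (fun x => F (x, y)) (F' (x, y)) x) :
    ∫ p, F' p = 0 := by
  rw [Measure.volume_eq_prod] at hF hF' ⊢
  rw [integral_prod_symm _ hF']
  refine integral_eq_zero_of_ae ?_
  filter_upwards [hF.prod_left_ae, hF'.prod_left_ae] with y hy hy'
  exact integral_eq_zero_of_hasDerivAt_of_integrable (fun x => h x y) hy' hy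

theorem integral_prod_eq_zero_of_hasDerivAt_snd {F F' : ℝ × ℝ → ℂ} (hF : Integrable F)
    (hF' : Integrable F') (h : ∀ x y, HasDerivAt (fun y => F (x, y)) (F' (x, y)) y) :
    ∫ p, F' p = 0 := by
  rw [Measure.volume_eq_prod] at hF hF' ⊢
  rw [integral_prod _ hF']
  refine integral_eq_zero_of_ae ?_
  filter_upwards [hF.prod_right_ae, hF'.prod_right_ae] with x hx hx'
  exact integral_eq_zero_of_hasDerivAt_of_integrable (fun y => h x y) hx' hx

open Polynomial in
theorem integral_planarIntegrand_X_mul {τ : ℝ} (h0 : 0 < τ) (h1 : τ < 1) (f g : ℂ[X]) :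
    ∫ p, planarIntegrand τ (X * f) g p =
        τ * (∫ p, planarIntegrand τ (derivative f) g p) +
          ∫ p, planarIntegrand τ f (derivative g) p ∧
    ∫ p, planarIntegrand τ f (X * g) p =
        (∫ p, planarIntegrand τ (derivative f) g p) +
          τ * ∫ p, planarIntegrand τ f (derivative g) p := by
  have hI := integrable_planarIntegrand h0 h1
  have hA := hI (derivative f) g
  have hB := hI f (derivative g)
  have hP := hI (X * f) g
  have hQ := hI f (X * g)
  have hx := integral_prod_eq_zero_of_hasDerivAt_fst (hI f g)
    ((hA.add hB).sub ((hP.add hQ).const_mul ((1 + τ : ℝ) : ℂ)⁻¹))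
    (hasDerivAt_planarIntegrand_fst τ f g)
  have hy := integral_prod_eq_zero_of_hasDerivAt_snd (hI f g)
    (((hA.sub hB).add ((hP.sub hQ).const_mul ((1 - τ : ℝ) : ℂ)⁻¹)).const_mul Complex.I)
    (hasDerivAt_planarIntegrand_snd τ f g)
  rw [integral_sub' (hA.add hB) ((hP.add hQ).const_mul _), integral_const_mul,
    integral_add' hA hB, integral_add' hP hQ] at hx
  rw [integral_const_mul, integral_add' (hA.sub hB) ((hP.sub hQ).const_mul _), integral_const_mul,
    integral_sub' hA hB, integral_sub' hP hQ, mul_eq_zero_iff_left Complex.I_ne_zero] at hy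
  have hp : ((1 + τ : ℝ) : ℂ) ≠ 0 := by exact_mod_cast (by positivity : (1 + τ) ≠ 0)
  have hm : ((1 - τ : ℝ) : ℂ) ≠ 0 := by exact_mod_cast (sub_pos.2 h1).ne'
  field_simp at hx hy
  push_cast at hx hy
  constructor
  · linear_combination (hy - hx) / 2
  · linear_combination -(hy + hx) / 2

open Polynomial in
theorem planarIntegrand_smul_left (τ : ℝ) (c : ℂ) (f g : ℂ[X]) (p : ℝ × ℝ) :
    planarIntegrand τ (C c * f) g p = c * planarIntegrand τ f g p := by
  simp only [planarIntegrand, eval_mul, eval_C]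
  ring

open Polynomial in
theorem planarIntegrand_smul_right (τ : ℝ) (c : ℂ) (f g : ℂ[X]) (p : ℝ × ℝ) :
    planarIntegrand τ f (C c * g) p = c * planarIntegrand τ f g p := by
  simp only [planarIntegrand, eval_mul, eval_C]
  ring

open Polynomial in
theorem integral_planarIntegrand_succ_left {τ : ℝ} (h0 : 0 < τ) (h1 : τ < 1) (m : ℕ) (g : ℂ[X]) :
    ∫ p, planarIntegrand τ (scaledHermitePoly τ (m + 1)) g p =
      ∫ p, planarIntegrand τ (scaledHermitePoly τ m) (derivative g) p := by
  have hI := integrable_planarIntegrand h0 h1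
  set f := scaledHermitePoly τ m with hf
  have h : planarIntegrand τ (scaledHermitePoly τ (m + 1)) g = fun p =>
      planarIntegrand τ (X * f) g p - τ * planarIntegrand τ (derivative f) g p := by
    funext p
    rw [← planarIntegrand_smul_left, scaledHermitePoly, ← hf]
    simp only [planarIntegrand, eval_sub]
    ring
  rw [h, integral_sub (hI _ _) ((hI _ _).const_mul _), integral_const_mul,
    (integral_planarIntegrand_X_mul h0 h1 f g).1]
  ring

open Polynomial in
theorem integral_planarIntegrand_succ_right {τ : ℝ} (h0 : 0 < τ) (h1 : τ < 1) (n : ℕ) (f : ℂ[X]) :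
    ∫ p, planarIntegrand τ f (scaledHermitePoly τ (n + 1)) p =
      ∫ p, planarIntegrand τ (derivative f) (scaledHermitePoly τ n) p := by
  have hI := integrable_planarIntegrand h0 h1
  set g := scaledHermitePoly τ n with hg
  have h : planarIntegrand τ f (scaledHermitePoly τ (n + 1)) = fun p =>
      planarIntegrand τ f (X * g) p - τ * planarIntegrand τ f (derivative g) p := by
    funext p
    rw [← planarIntegrand_smul_right, scaledHermitePoly, ← hg]
    simp only [planarIntegrand, eval_sub]
    ring
  rw [h, integral_sub (hI _ _) ((hI _ _).const_mul _), integral_const_mul,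
    (integral_planarIntegrand_X_mul h0 h1 f g).2]
  ring

theorem integral_ellipticWeight {τ : ℝ} (h0 : 0 < τ) :
    ∫ p, ellipticWeight τ p = Real.pi * Real.sqrt (1 - τ ^ 2) := by
  simp only [ellipticWeight_eq_mul]
  rw [Measure.volume_eq_prod, integral_prod_mul (fun x : ℝ => Real.exp (-(1 / (1 + τ)) * x ^ 2))
    (fun y : ℝ => Real.exp (-(1 / (1 - τ)) * y ^ 2)), integral_gaussian, integral_gaussian,
    ← Real.sqrt_mul (by positivity)]
  have h : Real.pi / (1 / (1 + τ)) * (Real.pi / (1 / (1 - τ))) = Real.pi ^ 2 * (1 - τ ^ 2) := by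
    simp only [div_div_eq_mul_div, div_one]
    ring
  rw [h, Real.sqrt_mul (by positivity), Real.sqrt_sq Real.pi_pos.le]

theorem integral_planarIntegrand_scaledHermitePoly {τ : ℝ} (h0 : 0 < τ) (h1 : τ < 1) (m n : ℕ) :
    ∫ p, planarIntegrand τ (scaledHermitePoly τ m) (scaledHermitePoly τ n) p =
      if m = n then ((Real.pi * Nat.factorial m * Real.sqrt (1 - τ ^ 2) : ℝ) : ℂ) else 0 := by
  induction m generalizing n with
  | zero =>
    cases n with
    | zero =>
      simp only [planarIntegrand, scaledHermitePoly, Polynomial.eval_one, mul_one]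
      rw [integral_complex_ofReal, integral_ellipticWeight h0]
      simp
    | succ n =>
      rw [integral_planarIntegrand_succ_right h0 h1]
      simp [scaledHermitePoly, planarIntegrand]
  | succ m ih =>
    rw [integral_planarIntegrand_succ_left h0 h1]
    cases n with
    | zero => simp [scaledHermitePoly, planarIntegrand]
    | succ n =>
      simp only [derivative_scaledHermitePoly_succ, planarIntegrand_smul_right]
      rw [integral_const_mul, ih]
      by_cases h : m = n
      · subst h
        simp only [if_true, Nat.factorial_succ]
        push_cast
        ring
      · simp [h]

/-- Planar orthogonality of the scaled Hermite polynomials: for `0 < τ < 1`,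
`∫_{ℝ²} e^{-x²/(1+τ) - y²/(1-τ)} C_m(x+iy) C_n(x-iy) dx dy = π m! √(1-τ²) δ_{mn}`. -/
theorem scaledHermite_planar_orthogonality (τ : ℝ) (h0 : 0 < τ) (h1 : τ < 1) (m n : ℕ) :
    (∫ p : ℝ × ℝ,
        ((Real.exp (-p.1 ^ 2 / (1 + τ) - p.2 ^ 2 / (1 - τ)) : ℝ) : ℂ) *
          scaledHermite τ m ((p.1 : ℂ) + (p.2 : ℂ) * Complex.I) *
          scaledHermite τ n ((p.1 : ℂ) - (p.2 : ℂ) * Complex.I))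
      = if m = n then
          ((Real.pi * Nat.factorial m * Real.sqrt (1 - τ ^ 2) : ℝ) : ℂ)
        else 0 := by
  simp only [scaledHermite_eq_eval τ h0]
  exact integral_planarIntegrand_scaledHermitePoly h0 h1 m n
end

section
/- Asymptotics of the thinned GinUE hole probability: fix 0 < α < 1 and 0 < ζ < 1, and let h(ζ) := ∫_0^∞ log( (1 − (ζ/2)(1 + erf(t/√2)))/(1−ζ) ) dt + ∫_0^∞ log( 1 − (ζ/2)(1 − erf(t/√2)) ) dt. Then, as N → ∞, log ∏_{j=1}^N ( 1 − ζ γ(j; α²N)/Γ(j) ) = α² N log(1−ζ) + α √N · h(ζ) + O(1); that is, the difference of the two sides is bounded in N. -/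
open MeasureTheory Finset Asymptotics

/-- The lower incomplete gamma function `γ(j;x) = ∫_0^x t^{j-1} e^{-t} dt`. -/
noncomputable def lowerGamma (j : ℕ) (x : ℝ) : ℝ :=
  ∫ t in (0:ℝ)..x, t ^ (j - 1) * Real.exp (-t)

/-- The (real) error function `erf(x) = (2/√π) ∫₀^x e^{-t²} dt`. -/
noncomputable def rerf (x : ℝ) : ℝ :=
  (2 / Real.sqrt Real.pi) * ∫ t in (0:ℝ)..x, Real.exp (-t ^ 2)

/-- The constant `h(ζ)` in the thinned GinUE hole probability asymptotics. -/
noncomputable def thinnedEdgeConstant (ζ : ℝ) : ℝ :=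
  (∫ t in Set.Ioi (0:ℝ),
      Real.log ((1 - (ζ / 2) * (1 + rerf (t / Real.sqrt 2))) / (1 - ζ))) +
  ∫ t in Set.Ioi (0:ℝ), Real.log (1 - (ζ / 2) * (1 - rerf (t / Real.sqrt 2)))

lemma continuous_exp_neg_sq : Continuous fun t : ℝ => Real.exp (-t ^ 2) := by fun_prop

lemma hasDerivAt_rerf (y : ℝ) :
    HasDerivAt rerf (2 / Real.sqrt Real.pi * Real.exp (-y ^ 2)) y :=
  ((continuous_exp_neg_sq.integral_hasStrictDerivAt 0 y).hasDerivAt).const_mul _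

lemma continuous_rerf : Continuous rerf :=
  continuous_iff_continuousAt.2 fun y => (hasDerivAt_rerf y).continuousAt

lemma rerf_neg (y : ℝ) : rerf (-y) = -rerf y := by
  have h := intervalIntegral.integral_comp_neg (a := 0) (b := y) (fun t : ℝ => Real.exp (-t ^ 2))
  simp only [neg_sq, neg_zero] at h
  rw [rerf, rerf, intervalIntegral.integral_symm, ← h]
  ring

lemma integrable_exp_neg_sq : Integrable fun t : ℝ => Real.exp (-t ^ 2) := by
  simpa using integrable_exp_neg_mul_sq one_pos

lemma one_sub_rerf (y : ℝ) :
    1 - rerf y = 2 / Real.sqrt Real.pi * ∫ t in Set.Ioi y, Real.exp (-t ^ 2) := by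
  have h := intervalIntegral.integral_interval_add_Ioi (μ := volume) (a := 0) (b := y)
    integrable_exp_neg_sq.integrableOn integrable_exp_neg_sq.integrableOn
  have h0 : ∫ t in Set.Ioi (0 : ℝ), Real.exp (-t ^ 2) = Real.sqrt Real.pi / 2 := by
    simpa using integral_gaussian_Ioi 1
  have hpi : Real.sqrt Real.pi ≠ 0 := (Real.sqrt_pos.2 Real.pi_pos).ne'
  rw [h0] at h
  rw [rerf, eq_sub_of_add_eq' h]
  field_simp

lemma one_sub_rerf_nonneg (y : ℝ) : 0 ≤ 1 - rerf y := by
  rw [one_sub_rerf]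
  exact mul_nonneg (by positivity) (integral_nonneg fun t => (Real.exp_pos _).le)

lemma one_le_sqrt_pi : 1 ≤ Real.sqrt Real.pi :=
  Real.one_le_sqrt.2 (by linarith [Real.pi_gt_three])

lemma one_sub_rerf_le (y : ℝ) : 1 - rerf y ≤ Real.exp (1 - 2 * y) := by
  rw [one_sub_rerf]
  have h2 : (-2 : ℝ) < 0 := by norm_num
  have hle : ∫ t in Set.Ioi y, Real.exp (-t ^ 2)
      ≤ ∫ t in Set.Ioi y, Real.exp 1 * Real.exp (-2 * t) := by
    refine setIntegral_mono integrable_exp_neg_sq.integrableOn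
      ((integrableOn_exp_mul_Ioi h2 y).const_mul _) fun t => ?_
    simp only [← Real.exp_add]
    exact Real.exp_le_exp.2 (by nlinarith [sq_nonneg (t - 1)])
  rw [integral_const_mul, integral_exp_mul_Ioi h2] at hle
  have he : Real.exp 1 * (-Real.exp (-2 * y) / -2) = Real.exp (1 - 2 * y) / 2 := by
    rw [sub_eq_add_neg, Real.exp_add, neg_mul]
    ring
  rw [he] at hle
  have hpi : 2 / Real.sqrt Real.pi ≤ 2 := div_le_self (by norm_num) one_le_sqrt_pi
  calc _ ≤ 2 * (Real.exp (1 - 2 * y) / 2) := by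
        gcongr
    _ = _ := by ring

/-- The distribution function of the standard normal law. -/
noncomputable def gaussCdf (u : ℝ) : ℝ := (1 + rerf (u / Real.sqrt 2)) / 2

/-- The density of the standard normal law. -/
noncomputable def gaussDensity (u : ℝ) : ℝ :=
  (Real.sqrt Real.pi * Real.sqrt 2)⁻¹ * Real.exp (-u ^ 2 / 2)

lemma hasDerivAt_gaussCdf (u : ℝ) : HasDerivAt gaussCdf (gaussDensity u) u := by
  have h := (((hasDerivAt_rerf (u / Real.sqrt 2)).comp u
    ((hasDerivAt_id u).div_const (Real.sqrt 2))).const_add 1).div_const 2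
  refine h.congr_deriv ?_
  rw [gaussDensity, div_pow, Real.sq_sqrt (by norm_num), neg_div]
  field_simp

lemma continuous_gaussCdf : Continuous gaussCdf :=
  continuous_iff_continuousAt.2 fun y => (hasDerivAt_gaussCdf y).continuousAt

lemma gaussDensity_pos (u : ℝ) : 0 < gaussDensity u := by
  have := Real.sqrt_pos.2 Real.pi_pos
  unfold gaussDensity
  positivity

lemma hasDerivAt_gaussDensity (u : ℝ) : HasDerivAt gaussDensity (-u * gaussDensity u) u := by
  have h := (((hasDerivAt_pow 2 u).neg.div_const 2).exp).const_mul
    (Real.sqrt Real.pi * Real.sqrt 2)⁻¹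
  refine h.congr_deriv ?_
  simp only [gaussDensity, Pi.neg_apply]
  push_cast
  ring

lemma one_add_sq_mul_gaussDensity_le (u : ℝ) :
    (1 + u ^ 2) * gaussDensity u ≤ 16 / (1 + u ^ 2) := by
  have hc : (Real.sqrt Real.pi * Real.sqrt 2)⁻¹ ≤ 1 :=
    inv_le_one_of_one_le₀ (one_le_mul_of_one_le_of_one_le one_le_sqrt_pi
      (Real.one_le_sqrt.2 (by norm_num)))
  have he : (1 + u ^ 2) ^ 2 / 16 ≤ Real.exp (u ^ 2 / 2) := by
    have h1 := Real.add_one_le_exp (u ^ 2 / 4)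
    calc (1 + u ^ 2) ^ 2 / 16 ≤ (u ^ 2 / 4 + 1) ^ 2 := by nlinarith [sq_nonneg u]
      _ ≤ Real.exp (u ^ 2 / 4) ^ 2 := by gcongr
      _ = _ := by rw [← Real.exp_nat_mul]; congr 1; push_cast; ring
  have hd : gaussDensity u ≤ (Real.exp (u ^ 2 / 2))⁻¹ := by
    rw [gaussDensity, ← Real.exp_neg, neg_div]
    exact mul_le_of_le_one_left (Real.exp_pos _).le hc
  have hi : (Real.exp (u ^ 2 / 2))⁻¹ ≤ ((1 + u ^ 2) ^ 2 / 16)⁻¹ :=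
    inv_anti₀ (by positivity) he
  calc (1 + u ^ 2) * gaussDensity u ≤ (1 + u ^ 2) * ((1 + u ^ 2) ^ 2 / 16)⁻¹ := by
        gcongr
        exact hd.trans hi
    _ = _ := by field_simp

lemma monotone_gaussCdf : Monotone gaussCdf :=
  monotone_of_hasDerivAt_nonneg hasDerivAt_gaussCdf fun u => (gaussDensity_pos u).le

lemma gaussCdf_neg (u : ℝ) : gaussCdf (-u) = 1 - gaussCdf u := by
  rw [gaussCdf, gaussCdf, neg_div, rerf_neg]
  ring

lemma gaussCdf_le_one (u : ℝ) : gaussCdf u ≤ 1 := by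
  have := one_sub_rerf_nonneg (u / Real.sqrt 2)
  unfold gaussCdf
  linarith

lemma gaussCdf_nonneg (u : ℝ) : 0 ≤ gaussCdf u := by
  linarith [gaussCdf_neg u, gaussCdf_le_one (-u)]

lemma gaussCdf_neg_le {u : ℝ} (hu : 0 ≤ u) : gaussCdf (-u) ≤ Real.exp (1 - u) := by
  have h := one_sub_rerf_le (u / Real.sqrt 2)
  have h2 : u ≤ 2 * (u / Real.sqrt 2) := by
    rw [← mul_div_assoc, le_div_iff₀ (by positivity), mul_comm]
    gcongr
    exact Real.sqrt_le_iff.2 ⟨by norm_num, by norm_num⟩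
  have h3 : Real.exp (1 - 2 * (u / Real.sqrt 2)) ≤ Real.exp (1 - u) :=
    Real.exp_le_exp.2 (by linarith)
  rw [gaussCdf_neg, gaussCdf]
  linarith [Real.exp_pos (1 - u)]

/-- The probability that a Poisson variable of mean `x` is at least `j`. -/
noncomputable def poissonTail (x : ℝ) (j : ℕ) : ℝ :=
  1 - ∑ i ∈ Finset.range j, Real.exp (-x) * x ^ i / (Nat.factorial i : ℝ)

lemma poissonTail_sub_succ (x : ℝ) (j : ℕ) :
    poissonTail x j - poissonTail x (j + 1) = Real.exp (-x) * x ^ j / (Nat.factorial j : ℝ) := by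
  rw [poissonTail, poissonTail, Finset.sum_range_succ]
  ring

lemma poissonTail_recurrence (x : ℝ) (j : ℕ) :
    (j + 1) * (poissonTail x (j + 1) - poissonTail x (j + 2))
      = x * (poissonTail x j - poissonTail x (j + 1)) := by
  rw [poissonTail_sub_succ, poissonTail_sub_succ, Nat.factorial_succ]
  have : (Nat.factorial j : ℝ) ≠ 0 := by positivity
  push_cast
  field_simp
  ring

lemma hasDerivAt_poissonTail (j : ℕ) (t : ℝ) :
    HasDerivAt (fun t => poissonTail t (j + 1))
      (t ^ j * Real.exp (-t) / (Nat.factorial j : ℝ)) t := by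
  have he : HasDerivAt (fun t : ℝ => Real.exp (-t)) (-Real.exp (-t)) t := by
    simpa using (hasDerivAt_neg t).exp
  induction j with
  | zero => simpa [poissonTail] using he.const_sub 1
  | succ j ih =>
    have h := ih.sub ((he.mul (hasDerivAt_pow (j + 1) t)).div_const (Nat.factorial (j + 1) : ℝ))
    refine (h.congr_of_eventuallyEq (.of_forall fun y => ?_)).congr_deriv ?_
    · simp only [Pi.sub_apply, Pi.mul_apply]
      linarith [poissonTail_sub_succ y (j + 1)]
    · have : (Nat.factorial j : ℝ) ≠ 0 := by positivity
      rw [Nat.factorial_succ]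
      push_cast
      field_simp
      ring

lemma lowerGamma_div_factorial (j : ℕ) (x : ℝ) :
    lowerGamma (j + 1) x / (Nat.factorial j : ℝ) = poissonTail x (j + 1) := by
  have h0 : poissonTail 0 (j + 1) = 0 := by
    simp [poissonTail, Finset.sum_range_succ']
  rw [lowerGamma, Nat.add_sub_cancel, ← intervalIntegral.integral_div,
    intervalIntegral.integral_eq_sub_of_hasDerivAt
      (f := fun t => poissonTail t (j + 1)) (fun t _ => hasDerivAt_poissonTail j t)
      (Continuous.intervalIntegrable (by fun_prop) _ _), h0, sub_zero]

lemma poissonTail_nonneg {x : ℝ} (hx : 0 ≤ x) (j : ℕ) : 0 ≤ poissonTail x j := by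
  rcases j with _ | j
  · simp [poissonTail]
  · rw [← lowerGamma_div_factorial]
    refine div_nonneg (intervalIntegral.integral_nonneg hx fun t ht => ?_) (by positivity)
    exact mul_nonneg (pow_nonneg ht.1 _) (Real.exp_pos _).le

lemma poissonTail_le_one {x : ℝ} (hx : 0 ≤ x) (j : ℕ) : poissonTail x j ≤ 1 :=
  sub_le_self _ (Finset.sum_nonneg fun i _ => by positivity)

lemma poissonTail_le_pow_div {x : ℝ} (hx : 0 ≤ x) (j : ℕ) :
    poissonTail x j ≤ x ^ j / (Nat.factorial j : ℝ) := by
  rcases j with _ | j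
  · simp [poissonTail]
  · rw [← lowerGamma_div_factorial, lowerGamma, Nat.add_sub_cancel]
    have h : ∫ t in (0 : ℝ)..x, t ^ j * Real.exp (-t) ≤ ∫ t in (0 : ℝ)..x, t ^ j := by
      refine intervalIntegral.integral_mono_on hx
        (Continuous.intervalIntegrable (by fun_prop) _ _)
        (Continuous.intervalIntegrable (by fun_prop) _ _) fun t ht => ?_
      exact mul_le_of_le_one_right (pow_nonneg ht.1 _) (Real.exp_le_one_iff.2 (by linarith [ht.1]))
    rw [integral_pow, zero_pow (Nat.succ_ne_zero j), sub_zero] at h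
    rw [Nat.factorial_succ]
    push_cast
    rw [← div_div]
    gcongr

/-- A discrete maximum principle in `ℓ¹` for the Poisson birth-death operator. -/
lemma sum_abs_le_of_recurrence {D r : ℕ → ℝ} {x : ℝ} (hx : 0 ≤ x)
    (h : ∀ j : ℕ, (x + j + 1) * D (j + 1) = x * D j + (j + 1) * D (j + 2) - r j) (M : ℕ) :
    ∑ k ∈ Finset.range M, |D (k + 1)| ≤
      x * |D 0| + (M + 1) * |D (M + 2)| + ∑ j ∈ Finset.range (M + 1), |r j| := by
  have habs : ∀ j : ℕ, (x + j + 1) * |D (j + 1)| ≤ x * |D j| + (j + 1) * |D (j + 2)| + |r j| := by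
    intro j
    calc (x + j + 1) * |D (j + 1)| = |(x + j + 1) * D (j + 1)| := by
          rw [abs_mul, abs_of_nonneg (by positivity : 0 ≤ x + j + 1)]
      _ = |x * D j + (j + 1) * D (j + 2) - r j| := by rw [h]
      _ ≤ |x * D j| + |(j + 1) * D (j + 2)| + |r j| :=
          (abs_sub _ _).trans (add_le_add_left (abs_add_le _ _) _)
      _ = _ := by
          rw [abs_mul, abs_mul, abs_of_nonneg hx, abs_of_nonneg (by positivity : (0 : ℝ) ≤ j + 1)]
  suffices ∑ k ∈ Finset.range M, |D (k + 1)| + (x + 1) * |D (M + 1)| ≤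
      x * |D 0| + (M + 1) * |D (M + 2)| + ∑ j ∈ Finset.range (M + 1), |r j| by
    have : 0 ≤ (x + 1) * |D (M + 1)| := by positivity
    linarith
  induction M with
  | zero => simpa using habs 0
  | succ M ih =>
    have := habs (M + 1)
    rw [Finset.sum_range_succ, Finset.sum_range_succ _ (M + 1)]
    push_cast at this ⊢
    simp only [add_assoc, Nat.reduceAdd] at this ih ⊢
    linarith

lemma exists_sub_eq_mul_of_hasDerivAt {f f' : ℝ → ℝ} (hf : ∀ t, HasDerivAt f (f' t) t)
    {a b : ℝ} (hab : a < b) : ∃ c ∈ Set.Ioo a b, f b - f a = f' c * (b - a) := by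
  obtain ⟨c, hc, h⟩ := exists_hasDerivAt_eq_slope f f' hab
    (fun t _ => (hf t).continuousAt.continuousWithinAt) fun t _ => hf t
  exact ⟨c, hc, by rw [h, div_mul_cancel₀ _ (sub_pos.2 hab).ne']⟩

lemma inv_one_add_sq_le_of_shift {u v c : ℝ} (h : |v - u| ≤ c) :
    1 / (1 + v ^ 2) ≤ (2 + 2 * c ^ 2) / (1 + u ^ 2) := by
  have hc : (v - u) ^ 2 ≤ c ^ 2 := sq_le_sq' (neg_le_of_abs_le h) (le_of_abs_le h)
  rw [div_le_div_iff₀ (by positivity) (by positivity)]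
  nlinarith [sq_nonneg (2 * v - u), mul_nonneg (sq_nonneg c) (sq_nonneg v), sq_nonneg c]

/-- Riemann sums of the Cauchy density with mesh `1 / s` are bounded. -/
lemma sum_inv_one_add_sq_le {s : ℝ} (hs : 1 ≤ s) (x : ℝ) (M : ℕ) :
    ∑ j ∈ Finset.range M, 1 / (s * (1 + ((j - x) / s) ^ 2)) ≤ 4 * Real.pi := by
  have hs0 : 0 < s := one_pos.trans_le hs
  have hder : ∀ t, HasDerivAt (fun t => Real.arctan ((t - x) / s))
      (1 / (1 + ((t - x) / s) ^ 2) * (1 / s)) t := fun t =>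
    (((hasDerivAt_id t).sub_const x).div_const s).arctan
  have hstep : ∀ j : ℕ, 1 / (s * (1 + ((j - x) / s) ^ 2)) ≤
      4 * (Real.arctan (((j + 1 : ℕ) - x) / s) - Real.arctan ((j - x) / s)) := by
    intro j
    obtain ⟨c, hc, h⟩ := exists_sub_eq_mul_of_hasDerivAt hder (lt_add_one (j : ℝ))
    push_cast
    rw [h]
    have hsh : |(j - x) / s - (c - x) / s| ≤ 1 := by
      rw [← sub_div, abs_div, abs_of_pos hs0, div_le_one hs0, abs_le]
      constructor <;> linarith [hc.1, hc.2]
    have := inv_one_add_sq_le_of_shift hsh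
    calc _ = 1 / (1 + ((j - x) / s) ^ 2) * (1 / s) := by field_simp
      _ ≤ (2 + 2 * 1 ^ 2) / (1 + ((c - x) / s) ^ 2) * (1 / s) := by gcongr
      _ = _ := by ring
  refine (Finset.sum_le_sum fun j _ => hstep j).trans ?_
  rw [← Finset.mul_sum, Finset.sum_range_sub (fun j : ℕ => Real.arctan ((j - x) / s))]
  have h1 := Real.arctan_lt_pi_div_two ((M - x) / s)
  have h2 := Real.neg_pi_div_two_lt_arctan (((0 : ℕ) - x) / s)
  linarith

/-- The residual of the Gaussian approximation in the Poisson tail recurrence. -/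
lemma abs_gaussCdf_residual_le {s : ℝ} (hs : 1 ≤ s) (j : ℝ) :
    |(j + 1) * (gaussCdf ((s ^ 2 - (j + 1)) / s) - gaussCdf ((s ^ 2 - (j + 2)) / s))
      - s ^ 2 * (gaussCdf ((s ^ 2 - j) / s) - gaussCdf ((s ^ 2 - (j + 1)) / s))|
      ≤ 320 * (1 / (s * (1 + ((j - s ^ 2) / s) ^ 2))) := by
  have hs0 : 0 < s := one_pos.trans_le hs
  set ψ : ℝ → ℝ := fun t => gaussCdf ((s ^ 2 - t) / s) with hψ
  set ρ : ℝ → ℝ := fun t => gaussDensity ((t - s ^ 2) / s) / s with hρ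
  have hu : ∀ t, HasDerivAt (fun t : ℝ => (t - s ^ 2) / s) (1 / s) t := fun t =>
    ((hasDerivAt_id t).sub_const _).div_const s
  have hψ' : ∀ t, HasDerivAt ψ (-ρ t) t := by
    intro t
    have h := (hasDerivAt_gaussCdf ((s ^ 2 - t) / s)).comp t
      (((hasDerivAt_id t).const_sub (s ^ 2)).div_const s)
    refine h.congr_deriv ?_
    simp only [hρ, gaussDensity]
    rw [show (s ^ 2 - t) / s = -((t - s ^ 2) / s) by ring, neg_sq]
    ring
  have hρ' : ∀ t, HasDerivAt ρ (-((t - s ^ 2) / s ^ 2) * ρ t) t := by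
    intro t
    have h := ((hasDerivAt_gaussDensity ((t - s ^ 2) / s)).comp t (hu t)).div_const s
    refine h.congr_deriv ?_
    simp only [hρ]
    field_simp
  have hK' : ∀ t, HasDerivAt (fun t => (t - s ^ 2) * ρ t)
      ((1 - ((t - s ^ 2) / s) ^ 2) * ρ t) t := by
    intro t
    refine (((hasDerivAt_id t).sub_const (s ^ 2)).mul (hρ' t)).congr_deriv ?_
    simp only [id]
    field_simp
    ring
  have hρ0 : ∀ t, 0 < ρ t := fun t => div_pos (gaussDensity_pos _) hs0
  have hbound : ∀ t, j ≤ t → t ≤ j + 2 →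
      (1 + ((t - s ^ 2) / s) ^ 2) * ρ t ≤ 160 * (1 / (s * (1 + ((j - s ^ 2) / s) ^ 2))) := by
    intro t h1 h2
    have hsh : |(t - s ^ 2) / s - (j - s ^ 2) / s| ≤ 2 := by
      rw [← sub_div, abs_div, abs_of_pos hs0, div_le_iff₀ hs0, abs_le]
      constructor <;> linarith
    calc _ = (1 + ((t - s ^ 2) / s) ^ 2) * gaussDensity ((t - s ^ 2) / s) / s := by
          simp only [hρ]; ring
      _ ≤ 16 / (1 + ((t - s ^ 2) / s) ^ 2) / s := by
          gcongr; exact one_add_sq_mul_gaussDensity_le _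
      _ = 16 * (1 / (1 + ((t - s ^ 2) / s) ^ 2)) / s := by ring
      _ ≤ 16 * ((2 + 2 * 2 ^ 2) / (1 + ((j - s ^ 2) / s) ^ 2)) / s := by
          gcongr 16 * ?_ / s
          exact inv_one_add_sq_le_of_shift hsh
      _ = _ := by field_simp; norm_num
  have hH : ∀ t, HasDerivAt (fun t => -(j + 1) * ψ (t + 1) + s ^ 2 * ψ t)
      ((j + 1) * ρ (t + 1) - s ^ 2 * ρ t) t := fun t =>
    ((((hψ' (t + 1)).comp_add_const t 1).const_mul (-(j + 1))).add
      ((hψ' t).const_mul (s ^ 2))).congr_deriv (by ring)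
  obtain ⟨θ, hθ, e1⟩ := exists_sub_eq_mul_of_hasDerivAt hH (lt_add_one j)
  obtain ⟨η, hη, e2⟩ := exists_sub_eq_mul_of_hasDerivAt hρ' (lt_add_one θ)
  obtain ⟨κ, hκ, e3⟩ := exists_sub_eq_mul_of_hasDerivAt hK' hη.2
  have e2' : s ^ 2 * (ρ (θ + 1) - ρ θ) = -((η - s ^ 2) * ρ η) := by
    rw [e2]; field_simp; ring
  have hr : (j + 1) * (ψ (j + 1) - ψ (j + 2)) - s ^ 2 * (ψ j - ψ (j + 1))
      = (1 - ((κ - s ^ 2) / s) ^ 2) * ρ κ * (θ + 1 - η) - (θ - j) * ρ (θ + 1) := by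
    have e1' : -(j + 1) * ψ (j + 2) + s ^ 2 * ψ (j + 1) - (-(j + 1) * ψ (j + 1) + s ^ 2 * ψ j)
        = (j + 1) * ρ (θ + 1) - s ^ 2 * ρ θ := by
      rw [show j + 2 = j + 1 + 1 by ring]
      linarith
    linarith
  have b1 := hbound κ (by linarith [hθ.1, hη.1, hκ.1]) (by linarith [hθ.2, hκ.2])
  have b2 := hbound (θ + 1) (by linarith [hθ.1]) (by linarith [hθ.2])
  have c1 : |(1 - ((κ - s ^ 2) / s) ^ 2) * ρ κ * (θ + 1 - η)|
      ≤ (1 + ((κ - s ^ 2) / s) ^ 2) * ρ κ := by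
    rw [abs_mul, abs_mul, abs_of_pos (hρ0 κ)]
    have : |1 - ((κ - s ^ 2) / s) ^ 2| ≤ 1 + ((κ - s ^ 2) / s) ^ 2 := by
      rw [abs_le]; constructor <;> nlinarith [sq_nonneg ((κ - s ^ 2) / s)]
    have h1 : |θ + 1 - η| ≤ 1 := by
      rw [abs_le]; constructor <;> linarith [hη.1, hη.2]
    calc _ ≤ (1 + ((κ - s ^ 2) / s) ^ 2) * ρ κ * 1 := by
          have := (hρ0 κ).le
          gcongr
      _ = _ := mul_one _
  have c2 : |(θ - j) * ρ (θ + 1)| ≤ (1 + ((θ + 1 - s ^ 2) / s) ^ 2) * ρ (θ + 1) := by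
    rw [abs_mul, abs_of_pos (hρ0 _)]
    refine mul_le_mul_of_nonneg_right ?_ (hρ0 _).le
    rw [abs_le]
    constructor <;> nlinarith [sq_nonneg ((θ + 1 - s ^ 2) / s), hθ.1, hθ.2]
  change |(j + 1) * (ψ (j + 1) - ψ (j + 2)) - s ^ 2 * (ψ j - ψ (j + 1))| ≤ _
  rw [hr]
  linarith [abs_sub ((1 - ((κ - s ^ 2) / s) ^ 2) * ρ κ * (θ + 1 - η)) ((θ - j) * ρ (θ + 1))]

lemma mul_exp_one_sub_le (v : ℝ) : v * Real.exp (1 - v) ≤ 1 := by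
  have h := Real.add_one_le_exp (v - 1)
  rw [show 1 - v = -(v - 1) by ring, Real.exp_neg, ← div_eq_mul_inv,
    div_le_one (Real.exp_pos _)]
  linarith

lemma sq_mul_exp_one_sub_le {v : ℝ} (hv : 0 ≤ v) : v ^ 2 * Real.exp (1 - v) ≤ 6 := by
  have h := Real.quadratic_le_exp_of_nonneg hv
  have h3 := Real.exp_one_lt_three
  rw [Real.exp_sub, ← mul_div_assoc, div_le_iff₀ (Real.exp_pos _)]
  nlinarith [sq_nonneg v]

/-- The `ℓ¹` distance between the Poisson tail and its Gaussian approximation is bounded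
uniformly in the mean. -/
lemma sum_abs_poissonTail_sub_gaussCdf_le {s : ℝ} (hs : 1 ≤ s) (N : ℕ) :
    ∑ k ∈ Finset.range N,
      |poissonTail (s ^ 2) (k + 1) - gaussCdf ((s ^ 2 - (k + 1 : ℕ)) / s)|
      ≤ 1280 * Real.pi + 19 := by
  have hs0 : 0 < s := one_pos.trans_le hs
  have hx : 0 ≤ s ^ 2 := sq_nonneg s
  set D : ℕ → ℝ := fun j => poissonTail (s ^ 2) j - gaussCdf ((s ^ 2 - j) / s) with hD
  obtain ⟨M, hMN, hMs, hMf⟩ : ∃ M : ℕ, N ≤ M ∧ 2 * s ^ 2 ≤ M ∧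
      s ^ 2 * ((s ^ 2) ^ (M + 1) / (Nat.factorial (M + 1) : ℝ)) ≤ 1 := by
    have h1 : ∀ᶠ M : ℕ in Filter.atTop,
        s ^ 2 * ((s ^ 2) ^ (M + 1) / (Nat.factorial (M + 1) : ℝ)) ≤ 1 := by
      have := (((FloorSemiring.tendsto_pow_div_factorial_atTop (s ^ 2)).comp
        (Filter.tendsto_add_atTop_nat 1)).const_mul (s ^ 2))
      rw [mul_zero] at this
      exact this.eventually_le_const one_pos
    obtain ⟨M, ⟨h1, h2⟩, h3⟩ := ((h1.and (tendsto_natCast_atTop_atTop.eventually_ge_atTop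
      (2 * s ^ 2))).and (Filter.eventually_ge_atTop N)).exists
    exact ⟨M, h3, h2, h1⟩
  have hrec := sum_abs_le_of_recurrence (D := D)
    (r := fun j => (j + 1) * (gaussCdf ((s ^ 2 - (j + 1)) / s) - gaussCdf ((s ^ 2 - (j + 2)) / s))
      - s ^ 2 * (gaussCdf ((s ^ 2 - j) / s) - gaussCdf ((s ^ 2 - (j + 1)) / s))) hx
    (fun j => by
      have := poissonTail_recurrence (s ^ 2) j
      simp only [hD]
      push_cast
      linarith) M
  have hr := (Finset.sum_le_sum fun (j : ℕ) (_ : j ∈ Finset.range (M + 1)) =>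
    abs_gaussCdf_residual_le hs (j : ℝ)).trans_eq (Finset.mul_sum _ _ _).symm
  have hc := sum_inv_one_add_sq_le hs (s ^ 2) (M + 1)
  have h0 : s ^ 2 * |D 0| ≤ 6 := by
    have e : D 0 = gaussCdf (-s) := by
      simp only [hD, poissonTail, Finset.range_zero, Finset.sum_empty, Nat.cast_zero, sub_zero]
      rw [gaussCdf_neg, sq, mul_div_assoc, div_self hs0.ne', mul_one]
    rw [e, abs_of_nonneg (gaussCdf_nonneg _)]
    exact (mul_le_mul_of_nonneg_left (gaussCdf_neg_le hs0.le) hx).trans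
      (sq_mul_exp_one_sub_le hs0.le)
  have hend : (M + 1) * |D (M + 2)| ≤ 13 := by
    have hG : (M + 1) * poissonTail (s ^ 2) (M + 2) ≤ 1 := by
      refine le_trans ?_ hMf
      calc (M + 1) * poissonTail (s ^ 2) (M + 2)
          ≤ (M + 2) * ((s ^ 2) ^ (M + 2) / (Nat.factorial (M + 2) : ℝ)) := by
            have := poissonTail_nonneg hx (M + 2)
            gcongr
            · norm_num
            · exact poissonTail_le_pow_div hx _
        _ = s ^ 2 * ((s ^ 2) ^ (M + 1) / (Nat.factorial (M + 1) : ℝ)) := by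
            rw [Nat.factorial_succ (M + 1)]
            push_cast
            field_simp
            ring
    have hP : (M + 1) * gaussCdf ((s ^ 2 - (M + 2 : ℕ)) / s) ≤ 12 := by
      set v : ℝ := ((M + 2 : ℕ) - s ^ 2) / s with hv
      have hsv : s * v = M + 2 - s ^ 2 := by rw [hv]; push_cast; field_simp
      have hv' : s ≤ v := by
        rw [hv, le_div_iff₀ hs0]; push_cast; nlinarith
      have hv0 : 0 ≤ v := hs0.le.trans hv'
      rw [show (s ^ 2 - (M + 2 : ℕ)) / s = -v by rw [hv]; ring]
      calc (M + 1) * gaussCdf (-v) ≤ (2 * v ^ 2) * Real.exp (1 - v) := by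
            have := gaussCdf_nonneg (-v)
            gcongr
            · nlinarith
            · exact gaussCdf_neg_le hv0
        _ ≤ 12 := by linarith [sq_mul_exp_one_sub_le hv0]
    have h1 : |D (M + 2)| ≤ poissonTail (s ^ 2) (M + 2)
        + gaussCdf ((s ^ 2 - (M + 2 : ℕ)) / s) := by
      refine (abs_sub _ _).trans_eq ?_
      rw [abs_of_nonneg (poissonTail_nonneg hx _), abs_of_nonneg (gaussCdf_nonneg _)]
    calc _ ≤ (M + 1) * (poissonTail (s ^ 2) (M + 2)
        + gaussCdf ((s ^ 2 - (M + 2 : ℕ)) / s)) := by gcongr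
      _ ≤ 13 := by linarith
  calc _ ≤ ∑ k ∈ Finset.range M, |D (k + 1)| :=
        Finset.sum_le_sum_of_subset_of_nonneg (Finset.range_subset_range.2 hMN)
          fun _ _ _ => abs_nonneg _
    _ ≤ _ := by linarith

lemma one_sub_mul_pos {ζ p : ℝ} (hζ0 : 0 < ζ) (hζ1 : ζ < 1) (hp : p ≤ 1) : 0 < 1 - ζ * p := by
  nlinarith

lemma abs_log_one_sub_mul_sub_le {ζ p q : ℝ} (hζ0 : 0 < ζ) (hζ1 : ζ < 1) (hp : p ≤ 1)
    (hq : q ≤ 1) : |Real.log (1 - ζ * p) - Real.log (1 - ζ * q)| ≤ |p - q| / (1 - ζ) := by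
  have key : ∀ {p q : ℝ}, p ≤ 1 → q ≤ 1 →
      Real.log (1 - ζ * p) - Real.log (1 - ζ * q) ≤ |p - q| / (1 - ζ) := by
    intro p q hp hq
    have hp0 := one_sub_mul_pos hζ0 hζ1 hp
    have hq0 := one_sub_mul_pos hζ0 hζ1 hq
    rw [← Real.log_div hp0.ne' hq0.ne']
    calc _ ≤ (1 - ζ * p) / (1 - ζ * q) - 1 := Real.log_le_sub_one_of_pos (div_pos hp0 hq0)
      _ = ζ * (q - p) / (1 - ζ * q) := by field_simp; ring
      _ ≤ |p - q| / (1 - ζ) := by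
        have : ζ * (q - p) ≤ |p - q| := by
          rw [abs_sub_comm]
          nlinarith [le_abs_self (q - p), abs_nonneg (q - p)]
        have : 1 - ζ ≤ 1 - ζ * q := by nlinarith
        gcongr
  rw [abs_le]
  constructor
  · have := key hq hp
    rw [abs_sub_comm] at this
    linarith
  · exact key hp hq

lemma continuous_log_one_sub_mul_gaussCdf {ζ : ℝ} (hζ0 : 0 < ζ) (hζ1 : ζ < 1) :
    Continuous fun u => Real.log (1 - ζ * gaussCdf u) :=
  (continuous_const.sub (continuous_const.mul continuous_gaussCdf)).log fun u =>
    (one_sub_mul_pos hζ0 hζ1 (gaussCdf_le_one u)).ne'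

lemma antitone_log_one_sub_mul_gaussCdf {ζ : ℝ} (hζ0 : 0 < ζ) (hζ1 : ζ < 1) :
    Antitone fun u => Real.log (1 - ζ * gaussCdf u) := by
  intro u v huv
  have := monotone_gaussCdf huv
  exact Real.log_le_log (one_sub_mul_pos hζ0 hζ1 (gaussCdf_le_one v)) (by gcongr)

/-- For a monotone function, a unit-step Riemann sum differs from the integral by at most the
total increment. -/
lemma abs_sum_sub_integral_le_of_monotone {f : ℝ → ℝ} (hf : Monotone f) (N : ℕ) :
    |∑ k ∈ Finset.range N, f (k + 1 : ℕ) - ∫ t in (0 : ℝ)..N, f t| ≤ f N - f 0 := by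
  have h1 := (hf.monotoneOn (Set.Icc 0 (0 + (N : ℝ)))).integral_le_sum
  have h2 := (hf.monotoneOn (Set.Icc 0 (0 + (N : ℝ)))).sum_le_integral
  have h3 := Finset.sum_range_sub (fun k : ℕ => f k) N
  rw [Finset.sum_sub_distrib] at h3
  simp only [zero_add] at h1 h2
  simp only [Nat.cast_zero] at h3
  rw [abs_le]
  constructor <;> linarith

lemma abs_integral_Ioi_sub_integral_le {g : ℝ → ℝ} {K : ℝ} (hg : Continuous g)
    (hK : ∀ u, 0 ≤ u → |g u| ≤ K * Real.exp (1 - u)) {y : ℝ} (hy : 0 ≤ y) :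
    |(∫ t in Set.Ioi (0 : ℝ), g t) - ∫ t in (0 : ℝ)..y, g t| ≤ K * Real.exp (1 - y) := by
  have he : ∀ c : ℝ, IntegrableOn (fun u : ℝ => K * Real.exp (1 - u)) (Set.Ioi c) := fun c => by
    simp only [sub_eq_add_neg, Real.exp_add]
    exact ((integrableOn_exp_neg_Ioi c).const_mul _).const_mul _
  have hb : ∀ c : ℝ, 0 ≤ c → ∀ᵐ u ∂(volume.restrict (Set.Ioi c)), ‖g u‖ ≤ K * Real.exp (1 - u) :=
    fun c hc => (ae_restrict_iff' measurableSet_Ioi).2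
      (.of_forall fun u hu => hK u (hc.trans (le_of_lt hu)))
  have hi : ∀ c : ℝ, 0 ≤ c → IntegrableOn g (Set.Ioi c) := fun c hc =>
    (he c).mono' hg.aestronglyMeasurable (hb c hc)
  rw [← intervalIntegral.integral_interval_add_Ioi (hi 0 le_rfl) (hi y hy), add_sub_cancel_left]
  refine (norm_integral_le_of_norm_le (he y) (hb y hy)).trans_eq ?_
  simp only [sub_eq_add_neg, Real.exp_add]
  rw [integral_const_mul, integral_const_mul, integral_exp_neg_Ioi]

/-- The integral of the Gaussian profile over `[0, N]`, up to exponentially small tails. -/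
lemma abs_integral_profile_sub_le {ζ : ℝ} (hζ0 : 0 < ζ) (hζ1 : ζ < 1) {s : ℝ} (hs : 0 < s)
    {y : ℝ} (hy : 0 ≤ y) :
    |(∫ t in (0 : ℝ)..s ^ 2 + s * y, Real.log (1 - ζ * gaussCdf ((s ^ 2 - t) / s)))
      - (s ^ 2 * Real.log (1 - ζ) + s * thinnedEdgeConstant ζ)|
      ≤ 1 / (1 - ζ) * (s * Real.exp (1 - s) + s * Real.exp (1 - y)) := by
  set L : ℝ → ℝ := fun u => Real.log (1 - ζ * gaussCdf u) with hL
  have hLc : Continuous L := continuous_log_one_sub_mul_gaussCdf hζ0 hζ1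
  have hg1 : ∀ u, Real.log ((1 - (ζ / 2) * (1 + rerf (u / Real.sqrt 2))) / (1 - ζ))
      = L u - Real.log (1 - ζ) := fun u => by
    have e : 1 - (ζ / 2) * (1 + rerf (u / Real.sqrt 2)) = 1 - ζ * gaussCdf u := by
      rw [gaussCdf]; ring
    rw [e, Real.log_div (one_sub_mul_pos hζ0 hζ1 (gaussCdf_le_one u)).ne' (by linarith)]
  have hg2 : ∀ u, Real.log (1 - (ζ / 2) * (1 - rerf (u / Real.sqrt 2))) = L (-u) := fun u => by
    simp only [hL]
    rw [gaussCdf_neg, gaussCdf]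
    ring_nf
  have hb1 := abs_integral_Ioi_sub_integral_le (g := fun u => L u - Real.log (1 - ζ))
    (K := 1 / (1 - ζ)) (hLc.sub continuous_const) (fun u hu => by
      have h := abs_log_one_sub_mul_sub_le hζ0 hζ1 (gaussCdf_le_one u) le_rfl
      rw [mul_one, abs_sub_comm (gaussCdf u), ← gaussCdf_neg,
        abs_of_nonneg (gaussCdf_nonneg _)] at h
      refine h.trans ?_
      rw [div_mul_eq_mul_div, one_mul]
      have : 0 < 1 - ζ := by linarith
      gcongr
      exact gaussCdf_neg_le hu) hs.le
  have hb2 := abs_integral_Ioi_sub_integral_le (g := fun u => L (-u))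
    (K := 1 / (1 - ζ)) (hLc.comp continuous_neg) (fun u hu => by
      have h := abs_log_one_sub_mul_sub_le hζ0 hζ1 (gaussCdf_le_one (-u)) zero_le_one
      rw [mul_zero, sub_zero, Real.log_one, sub_zero, sub_zero,
        abs_of_nonneg (gaussCdf_nonneg _)] at h
      refine h.trans ?_
      rw [div_mul_eq_mul_div, one_mul]
      have : 0 < 1 - ζ := by linarith
      gcongr
      exact gaussCdf_neg_le hu) hy
  have hsub : ∫ t in (0 : ℝ)..s ^ 2 + s * y, L ((s ^ 2 - t) / s)
      = s * ∫ u in (-y)..s, L u := by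
    have h := intervalIntegral.integral_comp_sub_div (a := 0) (b := s ^ 2 + s * y) L hs.ne' s
    have e : ∀ t, (s ^ 2 - t) / s = s - t / s := fun t => by field_simp
    have e' : s - (s ^ 2 + s * y) / s = -y := by field_simp; ring
    simp only [e]
    rw [h, e', zero_div, sub_zero, smul_eq_mul]
  have hsplit : ∫ u in (-y)..s, L u
      = (∫ u in (0 : ℝ)..y, L (-u)) + ∫ u in (0 : ℝ)..s, L u := by
    rw [intervalIntegral.integral_comp_neg, neg_zero,
      intervalIntegral.integral_add_adjacent_intervals (hLc.intervalIntegrable _ _)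
        (hLc.intervalIntegrable _ _)]
  rw [intervalIntegral.integral_sub (hLc.intervalIntegrable _ _) intervalIntegrable_const,
    intervalIntegral.integral_const, smul_eq_mul, sub_zero] at hb1
  change |(∫ t in (0 : ℝ)..s ^ 2 + s * y, L ((s ^ 2 - t) / s)) - _| ≤ _
  rw [hsub, hsplit, thinnedEdgeConstant]
  simp only [hg1, hg2]
  set A := ∫ u in Set.Ioi (0 : ℝ), (L u - Real.log (1 - ζ))
  set B := ∫ u in Set.Ioi (0 : ℝ), L (-u)
  set a := ∫ u in (0 : ℝ)..s, L u
  set b := ∫ u in (0 : ℝ)..y, L (-u)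
  calc |s * (b + a) - (s ^ 2 * Real.log (1 - ζ) + s * (A + B))|
      = s * |(A - (a - s * Real.log (1 - ζ))) + (B - b)| := by
        rw [← abs_of_pos hs, ← abs_mul, abs_of_pos hs, ← abs_neg]
        congr 1
        ring
    _ ≤ s * (1 / (1 - ζ) * Real.exp (1 - s) + 1 / (1 - ζ) * Real.exp (1 - y)) := by
        gcongr
        exact (abs_add_le _ _).trans (add_le_add hb1 hb2)
    _ = _ := by ring

lemma log_prod_eq_sum_log_poissonTail {ζ x : ℝ} (hζ0 : 0 < ζ) (hζ1 : ζ < 1) (hx : 0 ≤ x)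
    (N : ℕ) :
    Real.log (∏ j ∈ Finset.Icc 1 N, (1 - ζ * lowerGamma j x / (Nat.factorial (j - 1) : ℝ)))
      = ∑ k ∈ Finset.range N, Real.log (1 - ζ * poissonTail x (k + 1)) := by
  have h : ∏ j ∈ Finset.Icc 1 N, (1 - ζ * lowerGamma j x / (Nat.factorial (j - 1) : ℝ))
      = ∏ k ∈ Finset.range N, (1 - ζ * poissonTail x (k + 1)) := by
    induction N with
    | zero => simp
    | succ N ih =>
      rw [Finset.prod_Icc_succ_top (by omega), ih, Finset.prod_range_succ,
        ← lowerGamma_div_factorial, Nat.add_sub_cancel, mul_div_assoc]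
  rw [h, Real.log_prod fun k _ => (one_sub_mul_pos hζ0 hζ1 (poissonTail_le_one hx _)).ne']

/-- Asymptotics of the thinned GinUE hole probability: for `0 < α < 1`, `0 < ζ < 1`,
`log ∏_{j=1}^N (1 - ζ γ(j;α²N)/Γ(j)) = α²N log(1-ζ) + α√N h(ζ) + O(1)` as `N → ∞`. -/
theorem thinned_ginue_hole_probability (α ζ : ℝ)
    (hα0 : 0 < α) (hα1 : α < 1) (hζ0 : 0 < ζ) (hζ1 : ζ < 1) :
    (fun N : ℕ =>
        Real.log (∏ j ∈ Finset.Icc 1 N,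
            (1 - ζ * lowerGamma j (α ^ 2 * N) / (Nat.factorial (j - 1) : ℝ))) -
          (α ^ 2 * N * Real.log (1 - ζ) + α * Real.sqrt N * thinnedEdgeConstant ζ))
      =O[Filter.atTop] fun _ : ℕ => (1 : ℝ) := by
  have hα : α ^ 2 < 1 := by nlinarith
  set c : ℝ := 1 / α ^ 2 - 1 with hc
  have hc0 : 0 < c := by
    rw [hc, sub_pos, lt_div_iff₀ (by positivity)]
    linarith
  have hz : 0 < 1 - ζ := by linarith
  refine IsBigO.of_bound ((1280 * Real.pi + 19) / (1 - ζ) + -Real.log (1 - ζ)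
    + 1 / (1 - ζ) * (1 + 1 / c)) ?_
  filter_upwards [tendsto_natCast_atTop_atTop.eventually_ge_atTop (1 / α ^ 2)] with N hN
  rw [norm_one, mul_one, Real.norm_eq_abs]
  set s : ℝ := α * Real.sqrt N with hs
  have hs2 : s ^ 2 = α ^ 2 * N := by rw [hs, mul_pow, Real.sq_sqrt N.cast_nonneg]
  have hs1 : 1 ≤ s := by
    have h1 : 1 ≤ s ^ 2 := by
      rw [hs2, mul_comm]
      exact (div_le_iff₀ (by positivity)).1 hN
    have h0 : 0 ≤ s := by positivity
    nlinarith
  have hs0 : 0 < s := one_pos.trans_le hs1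
  have hN' : s ^ 2 + s * (s * c) = N := by
    have : s ^ 2 + s * (s * c) = s ^ 2 / α ^ 2 := by rw [hc]; ring
    rw [this, hs2]
    field_simp
  rw [← hs2, log_prod_eq_sum_log_poissonTail hζ0 hζ1 (sq_nonneg s)]
  set f : ℝ → ℝ := fun t => Real.log (1 - ζ * gaussCdf ((s ^ 2 - t) / s)) with hf
  have hfm : Monotone f := fun t t' h =>
    antitone_log_one_sub_mul_gaussCdf hζ0 hζ1 (by gcongr)
  have b1 : |∑ k ∈ Finset.range N, Real.log (1 - ζ * poissonTail (s ^ 2) (k + 1))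
      - ∑ k ∈ Finset.range N, f (k + 1 : ℕ)| ≤ (1280 * Real.pi + 19) / (1 - ζ) := by
    rw [← Finset.sum_sub_distrib]
    refine (Finset.abs_sum_le_sum_abs _ _).trans ((Finset.sum_le_sum fun k _ =>
      abs_log_one_sub_mul_sub_le hζ0 hζ1 (poissonTail_le_one (sq_nonneg s) _)
        (gaussCdf_le_one _)).trans ?_)
    rw [← Finset.sum_div]
    gcongr
    exact sum_abs_poissonTail_sub_gaussCdf_le hs1 N
  have b2 := abs_sum_sub_integral_le_of_monotone hfm N
  have hfN : f N ≤ 0 := Real.log_nonpos (one_sub_mul_pos hζ0 hζ1 (gaussCdf_le_one _)).le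
    (by nlinarith [gaussCdf_nonneg ((s ^ 2 - N) / s)])
  have hf0 : Real.log (1 - ζ) ≤ f 0 :=
    Real.log_le_log hz (by nlinarith [gaussCdf_le_one ((s ^ 2 - 0) / s)])
  have b3 := abs_integral_profile_sub_le hζ0 hζ1 hs0 (mul_nonneg hs0.le hc0.le)
  rw [hN'] at b3
  have b4 : 1 / (1 - ζ) * (s * Real.exp (1 - s) + s * Real.exp (1 - s * c))
      ≤ 1 / (1 - ζ) * (1 + 1 / c) := by
    gcongr
    · exact mul_exp_one_sub_le s
    · rw [le_div_iff₀ hc0]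
      linarith [mul_exp_one_sub_le (s * c)]
  have t1 := abs_sub_le (∑ k ∈ Finset.range N, Real.log (1 - ζ * poissonTail (s ^ 2) (k + 1)))
    (∑ k ∈ Finset.range N, f (k + 1 : ℕ)) (s ^ 2 * Real.log (1 - ζ) + s * thinnedEdgeConstant ζ)
  have t2 := abs_sub_le (∑ k ∈ Finset.range N, f (k + 1 : ℕ)) (∫ t in (0 : ℝ)..N, f t)
    (s ^ 2 * Real.log (1 - ζ) + s * thinnedEdgeConstant ζ)
  linarith
end

section
/- Laguerre Selberg integral at β = 2 (Mellin transform of the GinUE squared-determinant distribution): for every positive integer N and every complex s with Re s > 0, ∫_{[0,∞)^N} ∏_{j=1}^N s_j^{s-1} e^{-s_j} · ∏_{1≤j<k≤N} (s_k − s_j)² ds₁ ⋯ ds_N = N! ∏_{j=0}^{N-1} ( j! · Γ(s + j) ), where Γ denotes the Gamma function. In particular, dividing by the value at s = 1 gives ∏_{j=0}^{N-1} Γ(s+j)/Γ(1+j), the Mellin transform (at argument s) of the distribution of |det G|² for an N × N GinUE matrix G. -/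
open MeasureTheory Finset

/-- Andréief's identity: the integral of a product of two determinants is the determinant of
the matrix of pairwise integrals, up to a factorial. -/
theorem integral_det_mul_det {ι α : Type*} [Fintype ι] [DecidableEq ι] [MeasurableSpace α]
    (μ : Measure α) [SigmaFinite μ] (f g : ι → α → ℂ)
    (h : ∀ i j, Integrable (fun x => f i x * g j x) μ) :
    ∫ x, (Matrix.of fun i j => f i (x j)).det * (Matrix.of fun i j => g i (x j)).det
        ∂(Measure.pi fun _ : ι => μ) =
      (Nat.factorial (Fintype.card ι) : ℂ) *
        (Matrix.of fun i j => ∫ x, f i x * g j x ∂μ).det := by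
  have expand (x : ι → α) :
      (Matrix.of fun i j => f i (x j)).det * (Matrix.of fun i j => g i (x j)).det =
        ∑ σ : Equiv.Perm ι, ∑ τ : Equiv.Perm ι,
          ((Equiv.Perm.sign σ : ℤ) : ℂ) * ((Equiv.Perm.sign τ : ℤ) : ℂ) *
            ∏ i, (f (σ i) (x i) * g (τ i) (x i)) := by
    simp only [Matrix.det_apply', Matrix.of_apply, Finset.sum_mul_sum, Finset.prod_mul_distrib]
    refine Finset.sum_congr rfl fun σ _ => Finset.sum_congr rfl fun τ _ => by ring
  have hint (σ τ : Equiv.Perm ι) : Integrable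
      (fun x : ι → α => ((Equiv.Perm.sign σ : ℤ) : ℂ) * ((Equiv.Perm.sign τ : ℤ) : ℂ) *
        ∏ i, (f (σ i) (x i) * g (τ i) (x i))) (Measure.pi fun _ => μ) :=
    (Integrable.fintype_prod (f := fun i y => f (σ i) y * g (τ i) y)
      fun i => h (σ i) (τ i)).const_mul _
  simp_rw [expand]
  rw [integral_finsetSum _ fun σ _ => integrable_finsetSum _ fun τ _ => hint σ τ]
  have inner (σ : Equiv.Perm ι) :
      ∫ x, ∑ τ : Equiv.Perm ι, ((Equiv.Perm.sign σ : ℤ) : ℂ) * ((Equiv.Perm.sign τ : ℤ) : ℂ) *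
            ∏ i, (f (σ i) (x i) * g (τ i) (x i)) ∂(Measure.pi fun _ : ι => μ) =
        (Matrix.of fun i j => ∫ x, f i x * g j x ∂μ).det := by
    set M : Matrix ι ι ℂ := Matrix.of fun i j => ∫ x, f i x * g j x ∂μ with hM
    have hsq : ((Equiv.Perm.sign σ : ℤ) : ℂ) * ((Equiv.Perm.sign σ : ℤ) : ℂ) = 1 := by
      rw [← Int.cast_mul, ← Units.val_mul, Int.units_mul_self]; simp
    rw [integral_finsetSum _ fun τ _ => hint σ τ]
    calc _ = ((Equiv.Perm.sign σ : ℤ) : ℂ) * (M.submatrix σ id).det := by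
          rw [← Matrix.det_transpose, Matrix.det_apply', Finset.mul_sum]
          refine Finset.sum_congr rfl fun τ _ => ?_
          rw [integral_const_mul,
            integral_fintype_prod_eq_prod (fun i y => f (σ i) y * g (τ i) y), mul_assoc]
          simp [hM]
      _ = M.det := by rw [Matrix.det_permute, ← mul_assoc, hsq, one_mul]
  simp_rw [inner]
  simp [Fintype.card_perm]

theorem Complex.Gamma_add_nat_eq_mul_ascPochhammer_eval {z : ℂ} (hz : 0 < z.re) (n : ℕ) :
    Complex.Gamma (z + n) = Complex.Gamma z * (ascPochhammer ℂ n).eval z := by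
  induction n with
  | zero => simp
  | succ n ih =>
    have hne : z + n ≠ 0 := fun h0 => by
      have := congrArg Complex.re h0
      simp at this
      have : (0 : ℝ) ≤ n := n.cast_nonneg
      linarith
    rw [ascPochhammer_succ_eval, ← mul_assoc, ← ih, Nat.cast_succ, ← add_assoc,
      Complex.Gamma_add_one _ hne, mul_comm]

/-- The Hankel determinant of the moments of the Laguerre weight. -/
theorem det_Gamma_add_add (N : ℕ) {s : ℂ} (hs : 0 < s.re) :
    (Matrix.of fun i j : Fin N => Complex.Gamma (s + (i : ℕ) + (j : ℕ))).det =
      ∏ j ∈ range N, ((Nat.factorial j : ℂ) * Complex.Gamma (s + (j : ℂ))) := by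
  have hM : (Matrix.of fun i j : Fin N => Complex.Gamma (s + (i : ℕ) + (j : ℕ))) =
      Matrix.of fun i j : Fin N => Complex.Gamma (s + (i : ℕ)) *
        (Matrix.of fun i j : Fin N => (ascPochhammer ℂ j).eval (s + (i : ℕ))) i j := by
    ext i j
    have hre : 0 < (s + (i : ℕ)).re := by
      have : (0 : ℝ) ≤ (i : ℕ) := Nat.cast_nonneg _
      simp
      linarith
    simpa using Complex.Gamma_add_nat_eq_mul_ascPochhammer_eval hre j
  have hV : (Matrix.vandermonde fun i : Fin N => s + ((i : ℕ) : ℂ)).det =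
      ∏ j ∈ range N, (Nat.factorial j : ℂ) := by
    simp_rw [add_comm s]
    rw [Matrix.det_vandermonde_add]
    cases N with
    | zero => simp
    | succ n =>
      rw [Matrix.det_vandermonde_id_eq_superFactorial, ← Nat.prod_range_succ_factorial]
      exact Nat.cast_prod _ _
  rw [hM, Matrix.det_mul_column, prod_mul_distrib, ← hV,
    Matrix.det_eval_matrixOfPolynomials_eq_det_vandermonde _ (fun j : Fin N => ascPochhammer ℂ j)
      (fun i => ascPochhammer_natDegree (S := ℂ) (i : ℕ)) (fun i => monic_ascPochhammer _ _),
    Fin.prod_univ_eq_prod_range (fun i => Complex.Gamma (s + (i : ℂ))), mul_comm]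

/-- Laguerre Selberg integral at `β = 2` (Mellin transform of the GinUE
squared-determinant distribution): for `Re s > 0`,
`∫_{[0,∞)^N} ∏ s_j^{s-1} e^{-s_j} ∏_{j<k}(s_k - s_j)² ds = N! ∏_{j=0}^{N-1} (j! Γ(s+j))`. -/
theorem laguerre_selberg_beta_two (N : ℕ) (hN : 0 < N) (s : ℂ) (hs : 0 < s.re) :
    (∫ x in Set.univ.pi (fun _ : Fin N => Set.Ici (0:ℝ)),
        (∏ j, ((x j : ℂ) ^ (s - 1) * Complex.exp (-(x j : ℂ)))) *
          (((∏ j, ∏ k ∈ Finset.Ioi j, (x k - x j) ^ 2 : ℝ)) : ℂ))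
      = (Nat.factorial N : ℂ) *
          ∏ j ∈ Finset.range N, ((Nat.factorial j : ℂ) * Complex.Gamma (s + (j : ℂ))) := by
  have hre (n : ℕ) (m : ℕ) : 0 < (s + n + m).re := by
    have h1 : (0 : ℝ) ≤ n := Nat.cast_nonneg _
    have h2 : (0 : ℝ) ≤ m := Nat.cast_nonneg _
    simp
    linarith
  let f : Fin N → ℝ → ℂ := fun i y => ((y : ℂ) ^ (s - 1) * Complex.exp (-(y : ℂ))) *
    (y : ℂ) ^ (i : ℕ)
  let g : Fin N → ℝ → ℂ := fun i y => (y : ℂ) ^ (i : ℕ)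
  have hfg (i j : Fin N) : Set.EqOn
      (fun y : ℝ => (Real.exp (-y) : ℂ) * (y : ℂ) ^ (s + (i : ℕ) + (j : ℕ) - 1))
      (fun y => f i y * g j y) (Set.Ioi 0) := by
    intro y hy
    have hy0 : (y : ℂ) ≠ 0 := by exact_mod_cast (ne_of_gt hy)
    have : s + (i : ℕ) + (j : ℕ) - 1 = s - 1 + (i : ℕ) + (j : ℕ) := by ring
    simp only [f, g]
    rw [this, Complex.cpow_add _ _ hy0, Complex.cpow_add _ _ hy0, Complex.cpow_natCast,
      Complex.cpow_natCast]
    push_cast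
    ring
  have hint (i j : Fin N) :
      Integrable (fun y => f i y * g j y) (volume.restrict (Set.Ioi (0 : ℝ))) :=
    (integrableOn_congr_fun (hfg i j) measurableSet_Ioi).1
      (Complex.GammaIntegral_convergent (hre i j))
  have hmoment (i j : Fin N) : ∫ y in Set.Ioi (0 : ℝ), f i y * g j y =
      Complex.Gamma (s + (i : ℕ) + (j : ℕ)) := by
    rw [Complex.Gamma_eq_integral (hre i j), Complex.GammaIntegral]
    exact (setIntegral_congr_fun measurableSet_Ioi (hfg i j)).symm
  have hdet (x : Fin N → ℝ) :
      (∏ j, ((x j : ℂ) ^ (s - 1) * Complex.exp (-(x j : ℂ)))) *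
          (((∏ j, ∏ k ∈ Finset.Ioi j, (x k - x j) ^ 2 : ℝ)) : ℂ) =
        (Matrix.of fun i j => f i (x j)).det * (Matrix.of fun i j => g i (x j)).det := by
    have hg : (Matrix.of fun i j => g i (x j)).det =
        ∏ j, ∏ k ∈ Finset.Ioi j, ((x k : ℂ) - x j) := by
      rw [← Matrix.det_vandermonde, ← Matrix.det_transpose]
      rfl
    have hf : (Matrix.of fun i j => f i (x j)).det =
        (∏ j, ((x j : ℂ) ^ (s - 1) * Complex.exp (-(x j : ℂ)))) *
          (Matrix.of fun i j => g i (x j)).det :=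
      Matrix.det_mul_row _ _
    rw [hf, hg]
    push_cast
    simp only [prod_pow]
    ring
  simp_rw [hdet]
  rw [volume_pi, Measure.restrict_pi_pi, ← restrict_Ioi_eq_restrict_Ici,
    integral_det_mul_det _ f g hint]
  simp_rw [hmoment]
  rw [det_Gamma_add_add N hs, Fintype.card_fin]
end
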